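/- Let Φ = Σ_{k=1}^∞ λ_k u_k ∧ v_k be a canonical form of a normalized Φ ∈ h∧h with infinitely many nonzero λ_k, let B = Σ_{k=1}^∞ λ_k c_{k,↓} c_{k,↑}, and for M ∈ ℕ let Ψ_M = (B*)^M Ω. Then for every even N the state Ψ_{N/2} is nonzero and satisfies equality in the bound of Proposition 3: ⟨Ψ_{N/2}, B*B Ψ_{N/2}⟩ = (N/2)‖Ψ_{N/2}‖² − ((N−2)/4)·Σ_{k=1}^∞ λ_k²·(‖c_{k,↑}Ψ_{N/2}‖² + ‖c_{k,↓}Ψ_{N/2}‖²). -/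

import Mathlib

/- Setting: `H` is the one-particle Hilbert space `h`, `F` is the fermionic Fock space over
`h` (carrying annihilation operators `an f = c(f)` satisfying the CAR, with adjoints the
creation operators `c*(f)`, and vacuum `Ω`), and `T` is the two-particle space `h ⊗ h`
(realized by a bilinear map `tp`, with the antisymmetric tensors `h ∧ h` inside it). -/

open scoped ComplexOrder

notation "⟪" x ", " y "⟫_ℂ" => @inner ℂ _ _ x y
open ContinuousLinearMap

noncomputable section

/-- A family of annihilation operators `an f = c(f)` on a Fock space `F` satisfying the
canonical anticommutation relations `{c(f), c(g)} = 0` and `{c(f), c*(g)} = ⟪f, g⟫ • 1`. -/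
def SatisfiesCAR {H F : Type*} [NormedAddCommGroup H] [InnerProductSpace ℂ H]
    [NormedAddCommGroup F] [InnerProductSpace ℂ F] [CompleteSpace F]
    (an : H → F →L[ℂ] F) : Prop :=
  (∀ f g : H, an f ∘L an g + an g ∘L an f = 0) ∧
  (∀ f g : H, an f ∘L adjoint (an g) + adjoint (an g) ∘L an f = ⟪f, g⟫_ℂ • (1 : F →L[ℂ] F))

/-- The action of `B = ∑ₖ λₖ c_{k,↓} c_{k,↑}` (where `c_{k,↑} = an (u k)` and
`c_{k,↓} = an (v k)`) on a vector of the Fock space. -/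
def applyB {H F : Type*} [NormedAddCommGroup F] [InnerProductSpace ℂ F]
    (an : H → F →L[ℂ] F) (u v : ℕ → H) (lam : ℕ → ℝ) (ψ : F) : F :=
  ∑' k : ℕ, (lam k : ℂ) • an (v k) (an (u k) ψ)

/-- The action of `B* = ∑ₖ λₖ c*_{k,↑} c*_{k,↓}` on a vector of the Fock space. -/
def applyBd {H F : Type*} [NormedAddCommGroup F] [InnerProductSpace ℂ F] [CompleteSpace F]
    (an : H → F →L[ℂ] F) (u v : ℕ → H) (lam : ℕ → ℝ) (ψ : F) : F :=
  ∑' k : ℕ, (lam k : ℂ) • adjoint (an (u k)) (adjoint (an (v k)) ψ)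

/-- `ψ` belongs to the `N`-particle sector `⋀^N h` of the Fock space, i.e. `ψ` is an
eigenvector of the number operator `𝒩 = ∑ₖ (c*_{k,↑} c_{k,↑} + c*_{k,↓} c_{k,↓})` with
eigenvalue `N` (here the `u k` and `v k` jointly form an orthonormal basis of `h`). -/
def InSector {H F : Type*} [NormedAddCommGroup F] [InnerProductSpace ℂ F] [CompleteSpace F]
    (an : H → F →L[ℂ] F) (u v : ℕ → H) (N : ℕ) (ψ : F) : Prop :=
  ∑' k : ℕ, (adjoint (an (u k)) (an (u k) ψ) + adjoint (an (v k)) (an (v k) ψ)) = (N : ℂ) • ψ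

/-- `Ω` is the (normalized) vacuum vector: it is annihilated by every `an f`. -/
def IsVacuum {H F : Type*} [NormedAddCommGroup F] [InnerProductSpace ℂ F]
    (an : H → F →L[ℂ] F) (Ω : F) : Prop :=
  ‖Ω‖ = 1 ∧ ∀ f : H, an f Ω = 0

/-- The trial states `Ψ_M = (B*)^M Ω`. -/
def PsiM {H F : Type*} [NormedAddCommGroup F] [InnerProductSpace ℂ F] [CompleteSpace F]
    (an : H → F →L[ℂ] F) (u v : ℕ → H) (lam : ℕ → ℝ) (Ω : F) : ℕ → F
  | 0 => Ω
  | M + 1 => applyBd an u v lam (PsiM an u v lam Ω M)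

/-- `tp` realizes the Hilbert space `T` as the Hilbert tensor product `h ⊗ h`: inner
products of elementary tensors multiply, and elementary tensors span a dense subspace. -/
def IsHilbertTensorProduct {H T : Type*} [NormedAddCommGroup H] [InnerProductSpace ℂ H]
    [NormedAddCommGroup T] [InnerProductSpace ℂ T]
    (tp : H →ₗ[ℂ] H →ₗ[ℂ] T) : Prop :=
  (∀ x y z w : H, ⟪tp x y, tp z w⟫_ℂ = ⟪x, z⟫_ℂ * ⟪y, w⟫_ℂ) ∧
  (Submodule.span ℂ {t : T | ∃ x y : H, t = tp x y}).topologicalClosure = ⊤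

/-- The elementary antisymmetric tensor `x ∧ y = (x ⊗ y - y ⊗ x)/√2`. -/
def wedgeVec {H T : Type*} [NormedAddCommGroup H] [InnerProductSpace ℂ H]
    [NormedAddCommGroup T] [InnerProductSpace ℂ T]
    (tp : H →ₗ[ℂ] H →ₗ[ℂ] T) (x y : H) : T :=
  (((Real.sqrt 2 : ℝ) : ℂ))⁻¹ • (tp x y - tp y x)

/-- `Φ = ∑ₖ λₖ • (u k) ∧ (v k)` is a canonical form of `Φ ∈ h ∧ h`: the sequences
`(u k)` and `(v k)` are jointly orthonormal and jointly span `h`, `λₖ ≥ 0` and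
`∑ₖ λₖ² = 1`. -/
def CanonicalWedgeForm {H T : Type*} [NormedAddCommGroup H] [InnerProductSpace ℂ H]
    [NormedAddCommGroup T] [InnerProductSpace ℂ T]
    (tp : H →ₗ[ℂ] H →ₗ[ℂ] T) (u v : ℕ → H) (lam : ℕ → ℝ) (Φ : T) : Prop :=
  Orthonormal ℂ (Sum.elim u v) ∧
  (Submodule.span ℂ (Set.range u ∪ Set.range v)).topologicalClosure = ⊤ ∧
  (∀ k, 0 ≤ lam k) ∧ (∑' k : ℕ, lam k ^ 2) = 1 ∧
  Φ = ∑' k : ℕ, (lam k : ℂ) • wedgeVec tp (u k) (v k)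

/-- `G` is the two-body operator `γ₂^Ψ` associated with the state `Ψ`, characterized by
`⟪φ₁ ⊗ φ₂, G (ψ₁ ⊗ ψ₂)⟫ = ⟪Ψ, c*(ψ₁) c*(ψ₂) c(φ₂) c(φ₁) Ψ⟫`. -/
def IsTwoBodyOp {H F T : Type*} [NormedAddCommGroup H] [InnerProductSpace ℂ H]
    [NormedAddCommGroup F] [InnerProductSpace ℂ F] [CompleteSpace F]
    [NormedAddCommGroup T] [InnerProductSpace ℂ T]
    (tp : H →ₗ[ℂ] H →ₗ[ℂ] T) (an : H → F →L[ℂ] F) (Ψ : F) (G : T →L[ℂ] T) : Prop :=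
  ∀ p q r s : H,
    ⟪tp p q, G (tp r s)⟫_ℂ = ⟪Ψ, adjoint (an r) (adjoint (an s) (an q (an p Ψ)))⟫_ℂ


section Helpers

variable {H F : Type*} [NormedAddCommGroup H] [InnerProductSpace ℂ H]
    [NormedAddCommGroup F] [InnerProductSpace ℂ F] [CompleteSpace F]
    {an : H → F →L[ℂ] F}

lemma car_aa (h : SatisfiesCAR an) (f g : H) (x : F) :
    an f (an g x) = - an g (an f x) := by
  have := congrArg (fun T : F →L[ℂ] F => T x) (h.1 f g)
  simp at this
  exact eq_neg_of_add_eq_zero_left this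

lemma car_ad (h : SatisfiesCAR an) (f g : H) (x : F) :
    an f (adjoint (an g) x) = ⟪f, g⟫_ℂ • x - adjoint (an g) (an f x) := by
  have := congrArg (fun T : F →L[ℂ] F => T x) (h.2 f g)
  simp at this
  exact eq_sub_of_add_eq this

lemma car_dd (h : SatisfiesCAR an) (f g : H) (x : F) :
    adjoint (an f) (adjoint (an g) x) = - adjoint (an g) (adjoint (an f) x) := by
  apply ext_inner_left ℂ
  intro y
  rw [inner_neg_right, adjoint_inner_right, adjoint_inner_right, adjoint_inner_right,
    adjoint_inner_right, car_aa h g f, inner_neg_left]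

lemma car_norm (h : SatisfiesCAR an) (f : H) (hf : ‖f‖ = 1) (x : F) :
    ‖an f x‖ ^ 2 + ‖adjoint (an f) x‖ ^ 2 = ‖x‖ ^ 2 := by
  have h1 : ⟪adjoint (an f) x, adjoint (an f) x⟫_ℂ = ⟪x, x⟫_ℂ - ⟪an f x, an f x⟫_ℂ := by
    rw [adjoint_inner_left, car_ad h, inner_sub_right, adjoint_inner_right,
      inner_self_eq_norm_sq_to_K (𝕜 := ℂ) f, hf]
    simp
  simp only [inner_self_eq_norm_sq_to_K] at h1
  have : ‖adjoint (an f) x‖ ^ 2 = ‖x‖ ^ 2 - ‖an f x‖ ^ 2 := by exact_mod_cast h1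
  linarith

lemma an_le (h : SatisfiesCAR an) (f : H) (hf : ‖f‖ = 1) (x : F) : ‖an f x‖ ≤ ‖x‖ := by
  have := car_norm h f hf x
  exact abs_le_of_sq_le_sq' (by nlinarith [sq_nonneg ‖adjoint (an f) x‖]) (norm_nonneg _) |>.2

lemma ad_le (h : SatisfiesCAR an) (f : H) (hf : ‖f‖ = 1) (x : F) :
    ‖adjoint (an f) x‖ ≤ ‖x‖ := by
  have := car_norm h f hf x
  exact abs_le_of_sq_le_sq' (by nlinarith [sq_nonneg ‖an f x‖]) (norm_nonneg _) |>.2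

/-- pair creation -/
def Pd (an : H → F →L[ℂ] F) (u v : ℕ → H) (k : ℕ) : F →L[ℂ] F :=
  adjoint (an (u k)) ∘L adjoint (an (v k))

lemma Pd_apply (u v : ℕ → H) (k : ℕ) (x : F) :
    Pd an u v k x = adjoint (an (u k)) (adjoint (an (v k)) x) := rfl

lemma d_Pd (h : SatisfiesCAR an) (u v : ℕ → H) (k : ℕ) (f : H) (x : F) :
    Pd an u v k (adjoint (an f) x) = adjoint (an f) (Pd an u v k x) := by
  rw [Pd_apply, Pd_apply, car_dd h (v k) f, map_neg, car_dd h (u k) f, neg_neg]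

lemma Pd_comm (h : SatisfiesCAR an) (u v : ℕ → H) (k j : ℕ) (x : F) :
    Pd an u v k (Pd an u v j x) = Pd an u v j (Pd an u v k x) := by
  rw [Pd_apply u v j, d_Pd h, d_Pd h, ← Pd_apply]

structure ONUV (u v : ℕ → H) : Prop where
  uu : ∀ j k, ⟪u j, u k⟫_ℂ = if j = k then 1 else 0
  vv : ∀ j k, ⟪v j, v k⟫_ℂ = if j = k then 1 else 0
  uv : ∀ j k, ⟪u j, v k⟫_ℂ = 0
  vu : ∀ j k, ⟪v j, u k⟫_ℂ = 0
  nu : ∀ k, ‖u k‖ = 1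
  nv : ∀ k, ‖v k‖ = 1

lemma onuv_of {u v : ℕ → H} (h : Orthonormal ℂ (Sum.elim u v)) : ONUV u v := by
  have h' := (orthonormal_iff_ite (𝕜 := ℂ)).1 h
  refine ⟨fun j k => ?_, fun j k => ?_, fun j k => ?_, fun j k => ?_, fun k => ?_, fun k => ?_⟩
  · simpa using h' (Sum.inl j) (Sum.inl k)
  · simpa using h' (Sum.inr j) (Sum.inr k)
  · simpa using h' (Sum.inl j) (Sum.inr k)
  · simpa using h' (Sum.inr j) (Sum.inl k)
  · simpa using h.1 (Sum.inl k)
  · simpa using h.1 (Sum.inr k)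

variable {u v : ℕ → H}

lemma Pd_le (h : SatisfiesCAR an) (o : ONUV u v) (k : ℕ) (x : F) : ‖Pd an u v k x‖ ≤ ‖x‖ :=
  (ad_le h _ (o.nu k) _).trans (ad_le h _ (o.nv k) _)

lemma u_Pd (h : SatisfiesCAR an) (o : ONUV u v) (j k : ℕ) (x : F) :
    an (u j) (Pd an u v k x) =
      Pd an u v k (an (u j) x) + if j = k then adjoint (an (v j)) x else 0 := by
  rw [Pd_apply, Pd_apply, car_ad h, car_ad h, o.uu, o.uv]
  split_ifs with hjk
  · subst hjk; simp [add_comm]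
  · simp

lemma v_Pd (h : SatisfiesCAR an) (o : ONUV u v) (j k : ℕ) (x : F) :
    an (v j) (Pd an u v k x) =
      Pd an u v k (an (v j) x) - if j = k then adjoint (an (u j)) x else 0 := by
  rw [Pd_apply, Pd_apply, car_ad h, car_ad h, o.vv, o.vu]
  split_ifs with hjk
  · subst hjk; simp
  · simp

lemma inner_Pd (h : SatisfiesCAR an) (o : ONUV u v) (j k : ℕ) (x : F) :
    ⟪Pd an u v j x, Pd an u v k x⟫_ℂ = ⟪an (v k) (an (u k) x), an (v j) (an (u j) x)⟫_ℂ +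
      if j = k then ((‖x‖ ^ 2 - ‖an (u j) x‖ ^ 2 - ‖an (v j) x‖ ^ 2 : ℝ) : ℂ) else 0 := by
  rw [Pd_apply (an := an) u v j, adjoint_inner_left, adjoint_inner_left, u_Pd h o, map_add, v_Pd h o,
    inner_add_right, inner_sub_right, Pd_apply, adjoint_inner_right, adjoint_inner_right]
  split_ifs with hjk
  · subst hjk
    rw [car_ad h, o.vv, inner_sub_right, adjoint_inner_right, adjoint_inner_right]
    simp only [inner_self_eq_norm_sq_to_K]
    simp
    ring
  · simp

lemma norm_sum_Pd (h : SatisfiesCAR an) (o : ONUV u v) (lam : ℕ → ℝ) (S : Finset ℕ) (x : F) :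
    ‖∑ k ∈ S, (lam k : ℂ) • Pd an u v k x‖ ^ 2 ≤
      ‖∑ k ∈ S, (lam k : ℂ) • an (v k) (an (u k) x)‖ ^ 2 + (∑ k ∈ S, lam k ^ 2) * ‖x‖ ^ 2 := by
  have key : ((‖∑ k ∈ S, (lam k : ℂ) • Pd an u v k x‖ ^ 2 : ℝ) : ℂ) =
      ((‖∑ k ∈ S, (lam k : ℂ) • an (v k) (an (u k) x)‖ ^ 2 + ∑ k ∈ S, lam k ^ 2 *
        (‖x‖ ^ 2 - ‖an (u k) x‖ ^ 2 - ‖an (v k) x‖ ^ 2) : ℝ) : ℂ) := by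
    have e : ∀ y : F, ((‖y‖ ^ 2 : ℝ) : ℂ) = ⟪y, y⟫_ℂ := fun y => by
      rw [inner_self_eq_norm_sq_to_K]; simp
    rw [Complex.ofReal_add, e, e]
    simp only [sum_inner, inner_sum, inner_smul_left, inner_smul_right, inner_Pd h o]
    simp only [Finset.mul_sum, mul_add, Finset.sum_add_distrib]
    congr 1
    · rw [Finset.sum_comm]
      refine Finset.sum_congr rfl fun i _ => Finset.sum_congr rfl fun j _ => ?_
      simp only [Complex.conj_ofReal]
      ring
    · rw [Complex.ofReal_sum]
      refine Finset.sum_congr rfl fun i hi => ?_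
      rw [Finset.sum_eq_single i]
      · simp only [Complex.conj_ofReal, if_true]
        push_cast; ring
      · intro b _ hb
        simp [hb]
      · exact fun h => absurd hi h
  have key' := Complex.ofReal_injective key
  rw [key', Finset.sum_mul]
  gcongr with k hk
  nlinarith [sq_nonneg ‖an (u k) x‖, sq_nonneg ‖an (v k) x‖]

lemma summable_Pd (h : SatisfiesCAR an) (o : ONUV u v) {lam : ℕ → ℝ} (h0 : ∀ k, 0 ≤ lam k)
    (hs : Summable fun k => lam k ^ 2) (x : F) (C : ℝ)
    (hC : ∀ k, ‖an (v k) (an (u k) x)‖ ≤ C * lam k) :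
    Summable fun k => (lam k : ℂ) • Pd an u v k x := by
  set t := ∑' k, lam k ^ 2 with ht
  have bound : ∀ S : Finset ℕ, ‖∑ k ∈ S, (lam k : ℂ) • Pd an u v k x‖ ^ 2 ≤
      (C ^ 2 * t + ‖x‖ ^ 2) * ∑ k ∈ S, lam k ^ 2 := by
    intro S
    have h1 := norm_sum_Pd h o lam S x
    have h2 : ‖∑ k ∈ S, (lam k : ℂ) • an (v k) (an (u k) x)‖ ≤ C * ∑ k ∈ S, lam k ^ 2 := by
      rw [Finset.mul_sum]
      refine norm_sum_le_of_le _ fun k _ => ?_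
      rw [norm_smul, Complex.norm_real, Real.norm_of_nonneg (h0 k)]
      nlinarith [hC k, h0 k, mul_le_mul_of_nonneg_left (hC k) (h0 k)]
    have h3 : ∑ k ∈ S, lam k ^ 2 ≤ t := hs.sum_le_tsum S fun k _ => sq_nonneg _
    have h4 : 0 ≤ ∑ k ∈ S, lam k ^ 2 := Finset.sum_nonneg fun k _ => sq_nonneg _
    have h5 := pow_le_pow_left₀ (norm_nonneg _) h2 2
    have h6 : C ^ 2 * (∑ k ∈ S, lam k ^ 2) * (∑ k ∈ S, lam k ^ 2) ≤
      C ^ 2 * t * (∑ k ∈ S, lam k ^ 2) := by gcongr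
    nlinarith
  have ht0 : 0 ≤ t := tsum_nonneg fun k => sq_nonneg _
  set K := C ^ 2 * t + ‖x‖ ^ 2 with hK
  have hK0 : 0 ≤ K := by positivity
  rw [summable_iff_vanishing_norm]
  intro ε hε
  obtain ⟨s, hs'⟩ := (summable_iff_vanishing_norm.1 hs) (ε ^ 2 / (K + 1)) (by positivity)
  refine ⟨s, fun S hS => ?_⟩
  have h1 := hs' S hS
  have h4 : 0 ≤ ∑ k ∈ S, lam k ^ 2 := Finset.sum_nonneg fun k _ => sq_nonneg _
  rw [Real.norm_of_nonneg h4, lt_div_iff₀ (by positivity)] at h1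
  have h2 := bound S
  refine lt_of_pow_lt_pow_left₀ 2 hε.le ?_
  nlinarith

/-- the induction invariant -/
def PsiInv (an : H → F →L[ℂ] F) (u v : ℕ → H) (lam : ℕ → ℝ) (m : ℕ) (ψ χ : F) : Prop :=
  (∀ k, an (u k) ψ = (lam k : ℂ) • adjoint (an (v k)) χ) ∧
  (∀ k, an (v k) ψ = -((lam k : ℂ) • adjoint (an (u k)) χ)) ∧
  HasSum (fun k => (lam k : ℂ) • Pd an u v k χ) ((m : ℂ) • ψ)

lemma PsiInv.hasSum {lam : ℕ → ℝ} {m : ℕ} {ψ χ : F} (I : PsiInv an u v lam m ψ χ)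
    (h : SatisfiesCAR an) (o : ONUV u v) (h0 : ∀ k, 0 ≤ lam k)
    (hs : Summable fun k => lam k ^ 2) :
    HasSum (fun k => (lam k : ℂ) • Pd an u v k ψ) (applyBd an u v lam ψ) := by
  refine (summable_Pd h o h0 hs ψ ‖χ‖ fun k => ?_).hasSum
  rw [I.1, map_smul, norm_smul, Complex.norm_real, Real.norm_of_nonneg (h0 k), mul_comm]
  exact mul_le_mul_of_nonneg_right
    ((an_le h _ (o.nv k) _).trans (ad_le h _ (o.nv k) _)) (h0 k)

lemma PsiInv.step {lam : ℕ → ℝ} {m : ℕ} {ψ χ : F} (I : PsiInv an u v lam m ψ χ)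
    (h : SatisfiesCAR an) (o : ONUV u v) (h0 : ∀ k, 0 ≤ lam k)
    (hs : Summable fun k => lam k ^ 2) :
    PsiInv an u v lam (m + 1) (applyBd an u v lam ψ) (((m + 1 : ℕ) : ℂ) • ψ) := by
  have A := I.hasSum h o h0 hs
  obtain ⟨I1, I2, I3⟩ := I
  refine ⟨fun k => ?_, fun k => ?_, ?_⟩
  · have h1 := A.mapL (an (u k))
    have h2 : HasSum (fun j => (lam k : ℂ) • adjoint (an (v k)) ((lam j : ℂ) • Pd an u v j χ) +
        if j = k then (lam k : ℂ) • adjoint (an (v k)) ψ else 0)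
        ((lam k : ℂ) • adjoint (an (v k)) ((m : ℂ) • ψ) + (lam k : ℂ) • adjoint (an (v k)) ψ) :=
      ((I3.mapL (adjoint (an (v k)))).const_smul _).add (hasSum_ite_eq k _)
    have h3 : HasSum (fun j => an (u k) ((lam j : ℂ) • Pd an u v j ψ)) _ := h2.congr_fun fun j => by
      rw [map_smul, u_Pd h o, I1, map_smul, d_Pd h, map_smul]
      by_cases hjk : j = k
      · subst hjk; simp [smul_smul]
      · simp [hjk, Ne.symm hjk, smul_smul, mul_comm]
    rw [h1.unique h3]
    simp [smul_smul]
    module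
  · have h1 := A.mapL (an (v k))
    have h2 : HasSum (fun j => -((lam k : ℂ) • adjoint (an (u k)) ((lam j : ℂ) • Pd an u v j χ)) -
        if j = k then (lam k : ℂ) • adjoint (an (u k)) ψ else 0)
        (-((lam k : ℂ) • adjoint (an (u k)) ((m : ℂ) • ψ)) - (lam k : ℂ) • adjoint (an (u k)) ψ) :=
      ((I3.mapL (adjoint (an (u k)))).const_smul _).neg.sub (hasSum_ite_eq k _)
    have h3 : HasSum (fun j => an (v k) ((lam j : ℂ) • Pd an u v j ψ)) _ := h2.congr_fun fun j => by
      rw [map_smul, v_Pd h o, I2, map_neg, map_smul, d_Pd h, map_smul]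
      by_cases hjk : j = k
      · subst hjk; simp [smul_smul, smul_sub]
      · simp [hjk, Ne.symm hjk, smul_smul, mul_comm]
    rw [h1.unique h3]
    simp [smul_smul]
    module
  · have := A.const_smul (((m + 1 : ℕ) : ℂ))
    refine this.congr_fun fun j => ?_
    rw [map_smul, smul_comm]

lemma psi_inv {lam : ℕ → ℝ} (h : SatisfiesCAR an) (o : ONUV u v) (h0 : ∀ k, 0 ≤ lam k)
    (hs : Summable fun k => lam k ^ 2) {Ω : F} (hΩ : IsVacuum an Ω) (m : ℕ) :
    ∃ χ, PsiInv an u v lam m (PsiM an u v lam Ω m) χ := by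
  induction m with
  | zero => exact ⟨0, by simp [PsiM, hΩ.2], by simp [PsiM, hΩ.2], by simpa using hasSum_zero⟩
  | succ m ih =>
    obtain ⟨χ, I⟩ := ih
    exact ⟨_, I.step h o h0 hs⟩

lemma psi_ne {lam : ℕ → ℝ} (h : SatisfiesCAR an) (o : ONUV u v) (h0 : ∀ k, 0 ≤ lam k)
    (hs : Summable fun k => lam k ^ 2) {Ω : F} (hΩ : IsVacuum an Ω)
    (hsupp : {k : ℕ | lam k ≠ 0}.Infinite) (m : ℕ) :
    PsiM an u v lam Ω m ≠ 0 := by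
  induction m with
  | zero =>
    intro h1
    have := hΩ.1
    simp only [PsiM] at h1
    simp [h1] at this
  | succ m ih =>
    intro hz
    obtain ⟨χ, I⟩ := psi_inv h o h0 hs hΩ m
    have J := I.step h o h0 hs
    change PsiInv an u v lam (m + 1) (PsiM an u v lam Ω (m + 1)) _ at J
    set ψ := PsiM an u v lam Ω m
    have hb : ∀ k, lam k ≠ 0 → ‖ψ‖ ≤ lam k * ‖χ‖ := by
      intro k hk
      have h1 := J.1 k
      rw [hz, map_zero, map_smul, smul_smul] at h1
      have h2 : adjoint (an (v k)) ψ = 0 := by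
        refine (smul_eq_zero.1 h1.symm).resolve_left ?_
        refine mul_ne_zero (by exact_mod_cast hk) (by exact_mod_cast m.succ_ne_zero)
      have h3 := car_norm h _ (o.nv k) ψ
      rw [h2] at h3
      have h4 : ‖an (v k) ψ‖ = ‖ψ‖ := by
        have h5 : ‖an (v k) ψ‖ ^ 2 = ‖ψ‖ ^ 2 := by simpa using h3
        exact (pow_left_inj₀ (norm_nonneg _) (norm_nonneg _) two_ne_zero).1 h5
      rw [← h4, I.2.1, norm_neg, norm_smul, Complex.norm_real, Real.norm_of_nonneg (h0 k)]
      exact mul_le_mul_of_nonneg_left (ad_le h _ (o.nu k) _) (h0 k)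
    have hpos : 0 < ‖ψ‖ := norm_pos_iff.2 ih
    have hlim : Filter.Tendsto (fun k => lam k ^ 2 * ‖χ‖ ^ 2) Filter.atTop (nhds 0) := by
      simpa using hs.tendsto_atTop_zero.mul_const (‖χ‖ ^ 2)
    have hev := hlim.eventually (gt_mem_nhds (pow_pos hpos 2))
    obtain ⟨n, hn⟩ := Filter.eventually_atTop.1 hev
    obtain ⟨k, hk, hnk⟩ := hsupp.exists_gt n
    have h1 := hn k hnk.le
    have h2 := pow_le_pow_left₀ hpos.le (hb k hk) 2
    rw [mul_pow] at h2
    linarith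

lemma energy {lam : ℕ → ℝ} (h : SatisfiesCAR an) (o : ONUV u v) (h0 : ∀ k, 0 ≤ lam k)
    (hs : Summable fun k => lam k ^ 2) {ψ χ : F} {m : ℕ} (I : PsiInv an u v lam m ψ χ) {ψ' : F}
    (hψ' : ψ' = applyBd an u v lam ψ) (h1 : ∑' k, lam k ^ 2 = 1) :
    ⟪ψ', applyBd an u v lam (applyB an u v lam ψ')⟫_ℂ =
      ((((m : ℝ) + 1) * ‖ψ'‖ ^ 2 - (m : ℝ) / 2 *
          ∑' k : ℕ, lam k ^ 2 * (‖an (u k) ψ'‖ ^ 2 + ‖an (v k) ψ'‖ ^ 2) : ℝ) : ℂ) := by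
  have A := I.hasSum h o h0 hs
  have J := I.step h o h0 hs
  rw [← hψ'] at A J
  have hle : ∀ k, lam k ≤ 1 := fun k => by
    have := hs.le_tsum k fun j _ => sq_nonneg _
    rw [h1] at this
    nlinarith [h0 k]
  have hW : Summable fun k => ((lam k ^ 3 : ℝ) : ℂ) • Pd an u v k := by
    refine Summable.of_norm_bounded hs fun k => ?_
    rw [norm_smul, Complex.norm_real, Real.norm_of_nonneg (pow_nonneg (h0 k) 3)]
    have : ‖Pd an u v k‖ ≤ 1 := ContinuousLinearMap.opNorm_le_bound _ zero_le_one fun x => by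
      simpa using Pd_le h o k x
    have h3 : lam k ^ 3 ≤ lam k ^ 2 := by nlinarith [hle k, sq_nonneg (lam k)]
    calc lam k ^ 3 * ‖Pd an u v k‖ ≤ lam k ^ 3 * 1 :=
          mul_le_mul_of_nonneg_left this (pow_nonneg (h0 k) 3)
      _ ≤ _ := by simpa using h3
  obtain ⟨W, hW⟩ := hW
  have hWx : ∀ x, HasSum (fun k => ((lam k ^ 3 : ℝ) : ℂ) • Pd an u v k x) (W x) := fun x =>
    hW.mapL (ContinuousLinearMap.apply ℂ F x)
  have hcomm : ∀ j x, Pd an u v j (W x) = W (Pd an u v j x) := fun j x => by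
    refine ((hWx x).mapL (Pd an u v j)).unique ((hWx _).congr_fun fun k => ?_)
    rw [map_smul, Pd_comm h]
  have hs1 : HasSum (fun k => ((lam k ^ 2 : ℝ) : ℂ)) 1 := by
    have := hs.hasSum
    rw [h1] at this
    have h2 := Complex.hasSum_ofReal.2 this
    rw [Complex.ofReal_one] at h2
    exact h2
  have hB : applyB an u v lam ψ' = ((m : ℂ) + 1) • (ψ - W χ) := by
    refine HasSum.tsum_eq ?_
    have := ((hs1.smul_const ψ).sub (hWx χ)).const_smul ((m : ℂ) + 1)
    rw [one_smul] at this
    refine this.congr_fun fun k => ?_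
    rw [J.1, map_smul, car_ad h, o.vv, map_smul (an (v k)), I.2.1, smul_neg, map_neg,
      map_smul, map_smul, car_dd h (v k) (u k), ← Pd_apply]
    push_cast
    simp only [if_true]
    module
  have hBB : applyBd an u v lam (applyB an u v lam ψ') = ((m : ℂ) + 1) • (ψ' - (m : ℂ) • W ψ) := by
    rw [hB]
    refine HasSum.tsum_eq ?_
    have := (A.sub (I.2.2.mapL W)).const_smul ((m : ℂ) + 1)
    rw [map_smul] at this
    refine this.congr_fun fun k => ?_
    rw [← Pd_apply, map_smul, map_sub, hcomm, map_smul]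
    module
  have hS : ((∑' k : ℕ, lam k ^ 2 * (‖an (u k) ψ'‖ ^ 2 + ‖an (v k) ψ'‖ ^ 2) : ℝ) : ℂ) =
      2 * ((m : ℂ) + 1) * ⟪ψ', W ψ⟫_ℂ := by
    rw [Complex.ofReal_tsum]
    refine HasSum.tsum_eq ?_
    have := ((hWx ψ).mapL (innerSL ℂ ψ')).mul_left (2 * ((m : ℂ) + 1))
    refine this.congr_fun fun k => ?_
    have e : ∀ y : F, ((‖y‖ : ℝ) : ℂ) ^ 2 = ⟪y, y⟫_ℂ := fun y => by
      rw [inner_self_eq_norm_sq_to_K]; simp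
    have e1 : ⟪an (u k) ψ', an (u k) ψ'⟫_ℂ = lam k * (m + 1) * ⟪ψ', Pd an u v k ψ⟫_ℂ := by
      rw [← adjoint_inner_right, J.1]
      simp only [map_smul, inner_smul_right, ← Pd_apply]
      push_cast; ring
    have e2 : ⟪an (v k) ψ', an (v k) ψ'⟫_ℂ = lam k * (m + 1) * ⟪ψ', Pd an u v k ψ⟫_ℂ := by
      rw [← adjoint_inner_right, J.2.1, map_neg, map_smul, car_dd h (v k) (u k), smul_neg, neg_neg]
      simp only [map_smul, inner_smul_right, ← Pd_apply]
      push_cast; ring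
    push_cast
    rw [e, e, e1, e2]
    simp only [map_smul, innerSL_apply_apply, smul_eq_mul]
    ring
  rw [hBB, Complex.ofReal_sub, Complex.ofReal_mul _ (tsum _), hS, inner_smul_right, inner_sub_right,
    inner_smul_right, inner_self_eq_norm_sq_to_K]
  push_cast
  simp only [Complex.coe_algebraMap]
  ring

end Helpers

/-- **Optimality in Proposition 1.** If `(λₖ)` has infinite support then for every even
`N` the state `Ψ_{N/2} = (B*)^{N/2} Ω` is nonzero and attains equality in the bound
`⟪Ψ, B*B Ψ⟫ ≤ (N/2)‖Ψ‖² - (N-2)/4 · ∑ₖ λₖ²(‖c_{k,↑}Ψ‖² + ‖c_{k,↓}Ψ‖²)`. -/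
theorem PsiM_attains_equality
    {H F T : Type*} [NormedAddCommGroup H] [InnerProductSpace ℂ H] [CompleteSpace H]
    [NormedAddCommGroup F] [InnerProductSpace ℂ F] [CompleteSpace F]
    [NormedAddCommGroup T] [InnerProductSpace ℂ T] [CompleteSpace T]
    (an : H → F →L[ℂ] F) (hCAR : SatisfiesCAR an)
    (tp : H →ₗ[ℂ] H →ₗ[ℂ] T) (htp : IsHilbertTensorProduct tp)
    (u v : ℕ → H) (lam : ℕ → ℝ) (Φ : T) (hΦnorm : ‖Φ‖ = 1)
    (hΦ : CanonicalWedgeForm tp u v lam Φ)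
    (Ω : F) (hΩ : IsVacuum an Ω)
    (hsupp : {k : ℕ | lam k ≠ 0}.Infinite)
    (N : ℕ) (hNeven : Even N) :
    PsiM an u v lam Ω (N / 2) ≠ 0 ∧
      ⟪PsiM an u v lam Ω (N / 2),
          applyBd an u v lam (applyB an u v lam (PsiM an u v lam Ω (N / 2)))⟫_ℂ =
        (((N : ℝ) / 2 * ‖PsiM an u v lam Ω (N / 2)‖ ^ 2 - ((N : ℝ) - 2) / 4 *
          ∑' k : ℕ, lam k ^ 2 * (‖an (u k) (PsiM an u v lam Ω (N / 2))‖ ^ 2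
            + ‖an (v k) (PsiM an u v lam Ω (N / 2))‖ ^ 2) : ℝ) : ℂ) := by
  obtain ⟨r, rfl⟩ := hNeven
  have hr : (r + r) / 2 = r := by omega
  rw [hr]
  obtain ⟨horth, -, h0, h1, -⟩ := hΦ
  have o := onuv_of horth
  have hs : Summable fun k => lam k ^ 2 := by
    by_contra hn
    rw [tsum_eq_zero_of_not_summable hn] at h1
    exact zero_ne_one h1
  refine ⟨psi_ne hCAR o h0 hs hΩ hsupp r, ?_⟩
  cases r with
  | zero => simp [PsiM, applyB, applyBd, hΩ.2]
  | succ m =>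
    obtain ⟨χ, I⟩ := psi_inv hCAR o h0 hs hΩ m
    rw [energy hCAR o h0 hs I (ψ' := PsiM an u v lam Ω (m + 1)) rfl h1]
    congr 1
    push_cast
    ring
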